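/- arXiv:1612.04713 — 2 statements merged into one kernel-verified Lean document; each statement's English description precedes it below -/
import Mathlib

section
/- With a supermetric as in the context, define for u ∈ ℂ the complex matrix R(u) := u(u+β)·Id − ε(u+β)·P + u·K on I × I. On I × I × I, let R₁₂(u), R₂₃(u) act on the indicated pairs of factors (identity on the remaining factor), let R₁₃(u) act on the first and third factors, and let (−)¹² denote the sign operator acting on the first two factors, with entries (−1)^{[a1][a2]}δ^{a1}_{b1}δ^{a2}_{b2}δ^{a3}_{b3}. Then the graded Yang–Baxter equation holds for all u, v ∈ ℂ: R₁₂(u−v)·(−)¹²·R₁₃(u)·(−)¹²·R₂₃(v) = R₂₃(v)·(−)¹²·R₁₃(u)·(−)¹²·R₁₂(u−v). -/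
/-- The sign (−1)^x for a parity x ∈ ZMod 2. -/
noncomputable def sg (x : ZMod 2) : ℂ := if x = 0 then 1 else -1

/-- Baxterization of the Brauer algebra on three strands: `s, t` are the simple transpositions and
`e, f` the corresponding cup-cap generators with loop parameter `ω`. -/
theorem brauer_yang_baxter {A : Type*} [Ring A] [Algebra ℂ A] (s t e f : A) (ω : ℂ)
    (ss : s * s = 1) (tt : t * t = 1) (braid : t * (s * t) = s * (t * s))
    (se : s * e = e) (es : e * s = e) (tf : t * f = f) (ft : f * t = f)
    (ee : e * e = ω • e) (ff : f * f = ω • f)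
    (efe : e * (f * e) = e) (fef : f * (e * f) = f)
    (sfe : s * (f * e) = t * e) (efs : e * (f * s) = e * t) (u v : ℂ) :
    let β : ℂ := 1 - ω / 2
    let R : A → A → ℂ → A := fun p k w => (w * (w + β)) • (1 : A) - (w + β) • p + w • k
    R s e (u - v) * (s * R t f u * s) * R t f v = R t f v * (s * R t f u * s) * R s e (u - v) := by
  have two {a b c : A} (h : a * b = c) (x : A) : a * (b * x) = c * x := by
    rw [← mul_assoc, h]
  have three {a b c d : A} (h : a * (b * c) = d) (x : A) : a * (b * (c * x)) = d * x := by
    rw [← h]; simp only [mul_assoc]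
  have tef : t * (e * f) = s * f := by
    rw [← mul_assoc, ← sfe, mul_assoc, mul_assoc, fef]
  have fet : f * (e * t) = f * s := by
    rw [← efs, three fef]
  have ste : s * (t * e) = f * e := by
    rw [← sfe, two ss, one_mul]
  have ets : e * (t * s) = e * f := by
    rw [← mul_assoc, ← efs, mul_assoc, mul_assoc, ss, mul_one]
  have tsf : t * (s * f) = e * f := by
    rw [← tef, two tt, one_mul]
  have fst : f * (s * t) = f * e := by
    rw [← mul_assoc, ← fet, mul_assoc, mul_assoc, tt, mul_one]
  have ete : e * (t * e) = e := by
    rw [← mul_assoc, ← efs, mul_assoc, mul_assoc, se, efe]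
  have fsf : f * (s * f) = f := by
    rw [← mul_assoc, ← fet, mul_assoc, mul_assoc, tf, fef]
  have tet : t * (e * t) = s * (f * s) := by
    rw [← mul_assoc, ← sfe, mul_assoc, mul_assoc, fet]
  intro β R
  simp only [R, mul_add, add_mul, mul_sub, sub_mul, smul_mul_assoc, mul_smul_comm, mul_one, one_mul,
    mul_assoc, ss, tt, braid, se, es, tf, ft, ee, ff, sfe, efs, ste, ets, tsf, fst, ete,
    fsf, two ss, three braid, two se, two es, three tsf, three fst, three fsf, β]
  module

/-- A two-site matrix acting on the first two of three sites. -/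
def onFirstTwo {I : Type*} [DecidableEq I] (M : Matrix (I × I) (I × I) ℂ) :
    Matrix (I × I × I) (I × I × I) ℂ :=
  Matrix.of fun a b => M (a.1, a.2.1) (b.1, b.2.1) * (if a.2.2 = b.2.2 then 1 else 0)

/-- A two-site matrix acting on the last two of three sites. -/
def onLastTwo {I : Type*} [DecidableEq I] (M : Matrix (I × I) (I × I) ℂ) :
    Matrix (I × I × I) (I × I × I) ℂ :=
  Matrix.of fun a b => (if a.1 = b.1 then 1 else 0) * M (a.2.1, a.2.2) (b.2.1, b.2.2)

section Lifts

variable {I : Type*} [DecidableEq I]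

theorem onFirstTwo_one : onFirstTwo (1 : Matrix (I × I) (I × I) ℂ) = 1 := by
  ext ⟨a, b, c⟩ ⟨a', b', c'⟩
  simp only [onFirstTwo, Matrix.of_apply, Matrix.one_apply, Prod.mk.injEq]
  split_ifs <;> simp_all

theorem onLastTwo_one : onLastTwo (1 : Matrix (I × I) (I × I) ℂ) = 1 := by
  ext ⟨a, b, c⟩ ⟨a', b', c'⟩
  simp only [onLastTwo, Matrix.of_apply, Matrix.one_apply, Prod.mk.injEq]
  split_ifs <;> simp_all

theorem onFirstTwo_smul (x : ℂ) (M : Matrix (I × I) (I × I) ℂ) :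
    onFirstTwo (x • M) = x • onFirstTwo M := by
  ext a b
  simp [onFirstTwo]

theorem onLastTwo_smul (x : ℂ) (M : Matrix (I × I) (I × I) ℂ) :
    onLastTwo (x • M) = x • onLastTwo M := by
  ext a b
  simp [onLastTwo]

theorem onFirstTwo_add (M N : Matrix (I × I) (I × I) ℂ) :
    onFirstTwo (M + N) = onFirstTwo M + onFirstTwo N := by
  ext a b
  simp only [onFirstTwo, Matrix.of_apply, Matrix.add_apply, add_mul]

theorem onLastTwo_add (M N : Matrix (I × I) (I × I) ℂ) :
    onLastTwo (M + N) = onLastTwo M + onLastTwo N := by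
  ext a b
  simp only [onLastTwo, Matrix.of_apply, Matrix.add_apply, mul_add]

theorem onFirstTwo_sub (M N : Matrix (I × I) (I × I) ℂ) :
    onFirstTwo (M - N) = onFirstTwo M - onFirstTwo N := by
  ext a b
  simp only [onFirstTwo, Matrix.of_apply, Matrix.sub_apply, sub_mul]

theorem onLastTwo_sub (M N : Matrix (I × I) (I × I) ℂ) :
    onLastTwo (M - N) = onLastTwo M - onLastTwo N := by
  ext a b
  simp only [onLastTwo, Matrix.of_apply, Matrix.sub_apply, mul_sub]

variable [Fintype I]

theorem onFirstTwo_mul (M N : Matrix (I × I) (I × I) ℂ) :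
    onFirstTwo M * onFirstTwo N = onFirstTwo (M * N) := by
  ext ⟨a, b, c⟩ ⟨a', b', c'⟩
  simp [onFirstTwo, Matrix.mul_apply, Fintype.sum_prod_type]

theorem onLastTwo_mul (M N : Matrix (I × I) (I × I) ℂ) :
    onLastTwo M * onLastTwo N = onLastTwo (M * N) := by
  ext ⟨a, b, c⟩ ⟨a', b', c'⟩
  simp [onLastTwo, Matrix.mul_apply, Fintype.sum_prod_type]

end Lifts

theorem sg_mul_self (x : ZMod 2) : sg x * sg x = 1 := by
  unfold sg
  split_ifs <;> norm_num

theorem parity_eq_of_ne_zero {I : Type*} {p : I → ZMod 2} {M : Matrix I I ℂ}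
    (h0 : ∀ a b, p a + p b ≠ 0 → M a b = 0) {a b : I}
    (h : M a b ≠ 0) : p a = p b := by
  rw [← CharTwo.add_eq_zero]
  exact not_imp_comm.1 (h0 a b) h

section CupCap

variable {I : Type*}

/-- The rank-one operator built from a supermetric and its inverse. -/
def cupCap (hi lo : Matrix I I ℂ) : Matrix (I × I) (I × I) ℂ :=
  Matrix.of fun a b => hi a.1 a.2 * lo b.1 b.2

theorem cupCap_mul_self [Fintype I] (hi lo : Matrix I I ℂ) :
    cupCap hi lo * cupCap hi lo = (∑ a, ∑ b, hi a b * lo a b) • cupCap hi lo := by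
  ext ⟨a, b⟩ ⟨c, d⟩
  simp only [cupCap, Matrix.mul_apply, Fintype.sum_prod_type, Matrix.of_apply, Matrix.smul_apply,
    smul_eq_mul, Finset.sum_mul]
  exact Finset.sum_congr rfl fun _ _ => Finset.sum_congr rfl fun _ _ => by ring

end CupCap

section Superpermutation

variable {I : Type*} [DecidableEq I] (p : I → ZMod 2)

/-- The superpermutation of two sites. -/
noncomputable def superPerm : Matrix (I × I) (I × I) ℂ :=
  Matrix.of fun a b => sg (p a.1 * p a.2) * (if a.1 = b.2 then 1 else 0) *
    (if a.2 = b.1 then 1 else 0)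

variable [Fintype I]

theorem superPerm_mul_apply (M : Matrix (I × I) (I × I) ℂ) (a b : I) (y : I × I) :
    (superPerm p * M) (a, b) y = sg (p a * p b) * M (b, a) y := by
  simp [superPerm, Matrix.mul_apply, Fintype.sum_prod_type]

theorem mul_superPerm_apply (M : Matrix (I × I) (I × I) ℂ) (x : I × I) (a b : I) :
    (M * superPerm p) x (a, b) = sg (p a * p b) * M x (b, a) := by
  simp [superPerm, Matrix.mul_apply, Fintype.sum_prod_type, mul_comm]

theorem onFirstTwo_superPerm_mul_apply (M : Matrix (I × I × I) (I × I × I) ℂ)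
    (a b c : I) (y : I × I × I) :
    (onFirstTwo (superPerm p) * M) (a, b, c) y = sg (p a * p b) * M (b, a, c) y := by
  simp [onFirstTwo, superPerm, Matrix.mul_apply, Fintype.sum_prod_type]

theorem mul_onFirstTwo_superPerm_apply (M : Matrix (I × I × I) (I × I × I) ℂ)
    (x : I × I × I) (a b c : I) :
    (M * onFirstTwo (superPerm p)) x (a, b, c) = sg (p a * p b) * M x (b, a, c) := by
  simp [onFirstTwo, superPerm, Matrix.mul_apply, Fintype.sum_prod_type, mul_comm]

theorem onLastTwo_superPerm_mul_apply (M : Matrix (I × I × I) (I × I × I) ℂ)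
    (a b c : I) (y : I × I × I) :
    (onLastTwo (superPerm p) * M) (a, b, c) y = sg (p b * p c) * M (a, c, b) y := by
  simp [onLastTwo, superPerm, Matrix.mul_apply, Fintype.sum_prod_type]

theorem mul_onLastTwo_superPerm_apply (M : Matrix (I × I × I) (I × I × I) ℂ)
    (x : I × I × I) (a b c : I) :
    (M * onLastTwo (superPerm p)) x (a, b, c) = sg (p b * p c) * M x (a, c, b) := by
  simp [onLastTwo, superPerm, Matrix.mul_apply, Fintype.sum_prod_type, mul_comm]

theorem superPerm_mul_self : superPerm p * superPerm p = 1 := by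
  ext ⟨a, b⟩ ⟨c, d⟩
  rw [superPerm_mul_apply]
  simp only [superPerm, Matrix.of_apply, Matrix.one_apply, Prod.mk.injEq, ← mul_assoc,
    mul_comm (p b), sg_mul_self]
  split_ifs <;> simp_all

theorem superPerm_braid :
    onLastTwo (superPerm p) * (onFirstTwo (superPerm p) * onLastTwo (superPerm p)) =
      onFirstTwo (superPerm p) * (onLastTwo (superPerm p) * onFirstTwo (superPerm p)) := by
  ext ⟨a, b, c⟩ ⟨a', b', c'⟩
  simp only [onFirstTwo_superPerm_mul_apply, onLastTwo_superPerm_mul_apply]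
  simp only [onFirstTwo, onLastTwo, superPerm, Matrix.of_apply]
  split_ifs <;> ring

variable {p} {hi lo : Matrix I I ℂ} {ε : ℂ}

theorem superPerm_mul_cupCap (hsym : ∀ a b, hi a b = ε * sg (p a * p b) * hi b a) :
    superPerm p * cupCap hi lo = ε • cupCap hi lo := by
  ext ⟨a, b⟩ y
  simp only [superPerm_mul_apply, cupCap, Matrix.of_apply, Matrix.smul_apply, smul_eq_mul]
  rw [hsym b a, mul_comm (p b)]
  linear_combination ε * hi a b * lo y.1 y.2 * sg_mul_self (p a * p b)

theorem cupCap_mul_superPerm (hsym : ∀ a b, lo a b = ε * sg (p a * p b) * lo b a) :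
    cupCap hi lo * superPerm p = ε • cupCap hi lo := by
  ext x ⟨a, b⟩
  simp only [mul_superPerm_apply, cupCap, Matrix.of_apply, Matrix.smul_apply, smul_eq_mul]
  rw [hsym b a, mul_comm (p b)]
  linear_combination ε * hi x.1 x.2 * lo a b * sg_mul_self (p a * p b)

theorem cupCap_first_mul_last_apply (hinv : ∀ a c, ∑ b, lo a b * hi b c = if a = c then 1 else 0)
    (a b c a' b' c' : I) :
    (onFirstTwo (cupCap hi lo) * onLastTwo (cupCap hi lo)) (a, b, c) (a', b', c') =
      hi a b * lo b' c' * if a' = c then 1 else 0 := by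
  rw [← hinv]
  simp only [onFirstTwo, onLastTwo, cupCap, Matrix.mul_apply, Fintype.sum_prod_type,
    Matrix.of_apply, mul_ite, ite_mul, mul_one, one_mul, mul_zero, zero_mul, Finset.sum_ite_eq,
    Finset.sum_ite_eq', Finset.mem_univ, if_true, Finset.mul_sum, Finset.sum_const_zero,
    Finset.sum_ite_irrel]
  exact Finset.sum_congr rfl fun _ _ => by ring

theorem cupCap_last_mul_first_apply (hinv : ∀ a c, ∑ b, hi a b * lo b c = if a = c then 1 else 0)
    (a b c a' b' c' : I) :
    (onLastTwo (cupCap hi lo) * onFirstTwo (cupCap hi lo)) (a, b, c) (a', b', c') =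
      hi b c * lo a' b' * if a = c' then 1 else 0 := by
  rw [← hinv]
  simp only [onFirstTwo, onLastTwo, cupCap, Matrix.mul_apply, Fintype.sum_prod_type,
    Matrix.of_apply, mul_ite, ite_mul, mul_one, one_mul, mul_zero, zero_mul, Finset.sum_ite_eq,
    Finset.sum_ite_eq', Finset.mem_univ, if_true, Finset.mul_sum, Finset.sum_const_zero,
    Finset.sum_ite_irrel]
  exact Finset.sum_congr rfl fun _ _ => by ring

theorem cupCap_first_last_first
    (hinv_hi : ∀ a c, ∑ b, hi a b * lo b c = if a = c then 1 else 0)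
    (hinv_lo : ∀ a c, ∑ b, lo a b * hi b c = if a = c then 1 else 0) :
    onFirstTwo (cupCap hi lo) * (onLastTwo (cupCap hi lo) * onFirstTwo (cupCap hi lo)) =
      onFirstTwo (cupCap hi lo) := by
  ext ⟨a, b, c⟩ ⟨a', b', c'⟩
  rw [Matrix.mul_apply]
  simp only [Fintype.sum_prod_type, cupCap_last_mul_first_apply hinv_hi]
  simp only [onFirstTwo, cupCap, Matrix.of_apply, mul_ite, ite_mul, mul_one, mul_zero, zero_mul,
    Finset.sum_ite_eq, Finset.sum_ite_eq', Finset.mem_univ, if_true, Finset.sum_const_zero,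
    Finset.sum_ite_irrel]
  calc ∑ x, hi a b * lo c' x * (hi x c * lo a' b')
      = hi a b * lo a' b' * ∑ x, lo c' x * hi x c := by
        rw [Finset.mul_sum]
        exact Finset.sum_congr rfl fun _ _ => by ring
    _ = if c = c' then hi a b * lo a' b' else 0 := by
        rw [hinv_lo, mul_ite, mul_one, mul_zero]
        simp only [eq_comm]

theorem cupCap_last_first_last
    (hinv_hi : ∀ a c, ∑ b, hi a b * lo b c = if a = c then 1 else 0)
    (hinv_lo : ∀ a c, ∑ b, lo a b * hi b c = if a = c then 1 else 0) :
    onLastTwo (cupCap hi lo) * (onFirstTwo (cupCap hi lo) * onLastTwo (cupCap hi lo)) =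
      onLastTwo (cupCap hi lo) := by
  ext ⟨a, b, c⟩ ⟨a', b', c'⟩
  rw [Matrix.mul_apply]
  simp only [Fintype.sum_prod_type, cupCap_first_mul_last_apply hinv_lo]
  simp only [onLastTwo, cupCap, Matrix.of_apply, mul_ite, ite_mul, mul_one, one_mul, mul_zero,
    zero_mul,
    Finset.sum_ite_eq, Finset.mem_univ, if_true, Finset.sum_const_zero,
    Finset.sum_ite_irrel]
  calc ∑ x, hi b c * lo x a' * (hi a x * lo b' c')
      = hi b c * lo b' c' * ∑ x, hi a x * lo x a' := by
        rw [Finset.mul_sum]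
        exact Finset.sum_congr rfl fun _ _ => by ring
    _ = if a = a' then hi b c * lo b' c' else 0 := by
        rw [hinv_hi, mul_ite, mul_one, mul_zero]

theorem superPerm_cupCap_last_first (h0 : ∀ a b, p a + p b ≠ 0 → hi a b = 0)
    (hinv : ∀ a c, ∑ b, hi a b * lo b c = if a = c then 1 else 0) :
    onFirstTwo (superPerm p) * (onLastTwo (cupCap hi lo) * onFirstTwo (cupCap hi lo)) =
      onLastTwo (superPerm p) * onFirstTwo (cupCap hi lo) := by
  ext ⟨a, b, c⟩ ⟨a', b', c'⟩
  rw [onFirstTwo_superPerm_mul_apply, onLastTwo_superPerm_mul_apply,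
    cupCap_last_mul_first_apply hinv]
  simp only [onFirstTwo, cupCap, Matrix.of_apply]
  by_cases h : hi a c = 0
  · simp [h]
  · rw [parity_eq_of_ne_zero h0 h, mul_comm (p c), mul_assoc]

theorem cupCap_first_last_superPerm (h0 : ∀ a b, p a + p b ≠ 0 → lo a b = 0)
    (hinv : ∀ a c, ∑ b, lo a b * hi b c = if a = c then 1 else 0) :
    onFirstTwo (cupCap hi lo) * (onLastTwo (cupCap hi lo) * onFirstTwo (superPerm p)) =
      onFirstTwo (cupCap hi lo) * onLastTwo (superPerm p) := by
  ext ⟨a, b, c⟩ ⟨a', b', c'⟩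
  rw [← mul_assoc, mul_onFirstTwo_superPerm_apply, mul_onLastTwo_superPerm_apply,
    cupCap_first_mul_last_apply hinv]
  simp only [onFirstTwo, cupCap, Matrix.of_apply, eq_comm (a := c)]
  by_cases h : lo a' c' = 0
  · simp [h]
  · rw [parity_eq_of_ne_zero h0 h, mul_comm (p c')]

variable (p) in
/-- Conjugating by the sign operator turns the action on sites one and three into the conjugate of
the action on the last two sites by the superpermutation of the first two. -/
theorem sign_conj_eq_superPerm_conj (M : Matrix (I × I) (I × I) ℂ) :
    (Matrix.of fun a b : I × I × I => sg (p a.1 * p a.2.1) * (if a = b then 1 else 0)) *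
        (Matrix.of fun a b => M (a.1, a.2.2) (b.1, b.2.2) * (if a.2.1 = b.2.1 then 1 else 0)) *
        (Matrix.of fun a b : I × I × I => sg (p a.1 * p a.2.1) * (if a = b then 1 else 0)) =
      onFirstTwo (superPerm p) * onLastTwo M * onFirstTwo (superPerm p) := by
  have hdiag : (Matrix.of fun a b : I × I × I => sg (p a.1 * p a.2.1) * (if a = b then 1 else 0)) =
      Matrix.diagonal fun a => sg (p a.1 * p a.2.1) := by
    ext a b
    simp [Matrix.diagonal_apply]
  rw [hdiag]
  ext ⟨a, b, c⟩ ⟨a', b', c'⟩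
  rw [Matrix.mul_diagonal, Matrix.diagonal_mul, mul_onFirstTwo_superPerm_apply,
    onFirstTwo_superPerm_mul_apply]
  simp only [onLastTwo, Matrix.of_apply]
  ring

end Superpermutation

/-- The graded Yang–Baxter equation for the fundamental osp R-matrix
R(u) = u(u+β)·Id − ε(u+β)·P + u·K, with the sign operator (−)¹² inserted. -/
theorem graded_yang_baxter
    (n : ℕ) (p : Fin n → ZMod 2) (ε : ℂ) (hε : ε = 1 ∨ ε = -1)
    (εlo εhi : Matrix (Fin n) (Fin n) ℂ)
    (hlo0 : ∀ a b, p a + p b ≠ 0 → εlo a b = 0)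
    (hhi0 : ∀ a b, p a + p b ≠ 0 → εhi a b = 0)
    (hlosym : ∀ a b, εlo a b = ε * sg (p a * p b) * εlo b a)
    (hhisym : ∀ a b, εhi a b = ε * sg (p a * p b) * εhi b a)
    (hinv1 : ∀ a c, (∑ b, εhi a b * εlo b c) = if a = c then 1 else 0)
    (hinv2 : ∀ a c, (∑ b, εlo a b * εhi b c) = if a = c then 1 else 0) :
    let ω : ℂ := ∑ a, ∑ b, εhi a b * εlo a b
    let β : ℂ := 1 - ω / 2
    let P : Matrix (Fin n × Fin n) (Fin n × Fin n) ℂ :=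
      Matrix.of fun a b => sg (p a.1 * p a.2) * (if a.1 = b.2 then 1 else 0) *
        (if a.2 = b.1 then 1 else 0)
    let K : Matrix (Fin n × Fin n) (Fin n × Fin n) ℂ :=
      Matrix.of fun a b => εhi a.1 a.2 * εlo b.1 b.2
    let R : ℂ → Matrix (Fin n × Fin n) (Fin n × Fin n) ℂ := fun u =>
      (u * (u + β)) • (1 : Matrix (Fin n × Fin n) (Fin n × Fin n) ℂ) - (ε * (u + β)) • P + u • K
    let R12 : ℂ → Matrix (Fin n × Fin n × Fin n) (Fin n × Fin n × Fin n) ℂ := fun u =>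
      Matrix.of fun a b => R u (a.1, a.2.1) (b.1, b.2.1) * (if a.2.2 = b.2.2 then 1 else 0)
    let R23 : ℂ → Matrix (Fin n × Fin n × Fin n) (Fin n × Fin n × Fin n) ℂ := fun u =>
      Matrix.of fun a b => (if a.1 = b.1 then 1 else 0) * R u (a.2.1, a.2.2) (b.2.1, b.2.2)
    let R13 : ℂ → Matrix (Fin n × Fin n × Fin n) (Fin n × Fin n × Fin n) ℂ := fun u =>
      Matrix.of fun a b => R u (a.1, a.2.2) (b.1, b.2.2) * (if a.2.1 = b.2.1 then 1 else 0)
    let Sg12 : Matrix (Fin n × Fin n × Fin n) (Fin n × Fin n × Fin n) ℂ :=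
      Matrix.of fun a b => sg (p a.1 * p a.2.1) * (if a = b then 1 else 0)
    ∀ u v : ℂ,
      R12 (u - v) * Sg12 * R13 u * Sg12 * R23 v = R23 v * Sg12 * R13 u * Sg12 * R12 (u - v) := by
  intro ω β P K R R12 R23 R13 Sg12 u v
  have hεε : ε * ε = 1 := by
    rcases hε with rfl | rfl <;> norm_num
  have hconj : Sg12 * R13 u * Sg12 =
      onFirstTwo (superPerm p) * R23 u * onFirstTwo (superPerm p) :=
    sign_conj_eq_superPerm_conj p (R u)
  have hR12 (w : ℂ) : R12 w = (w * (w + β)) • (1 : Matrix _ _ ℂ) -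
      (w + β) • ε • onFirstTwo (superPerm p) + w • onFirstTwo (cupCap εhi εlo) := by
    change onFirstTwo ((w * (w + β)) • (1 : Matrix _ _ ℂ) - (ε * (w + β)) • superPerm p +
      w • cupCap εhi εlo) = _
    rw [onFirstTwo_add, onFirstTwo_sub, onFirstTwo_smul, onFirstTwo_smul, onFirstTwo_smul,
      onFirstTwo_one, smul_smul, mul_comm ε]
  have hR23 (w : ℂ) : R23 w = (w * (w + β)) • (1 : Matrix _ _ ℂ) -
      (w + β) • ε • onLastTwo (superPerm p) + w • onLastTwo (cupCap εhi εlo) := by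
    change onLastTwo ((w * (w + β)) • (1 : Matrix _ _ ℂ) - (ε * (w + β)) • superPerm p +
      w • cupCap εhi εlo) = _
    rw [onLastTwo_add, onLastTwo_sub, onLastTwo_smul, onLastTwo_smul, onLastTwo_smul,
      onLastTwo_one, smul_smul, mul_comm ε]
  have key := brauer_yang_baxter (ε • onFirstTwo (superPerm p)) (ε • onLastTwo (superPerm p))
    (onFirstTwo (cupCap εhi εlo)) (onLastTwo (cupCap εhi εlo)) ω
    (by rw [smul_mul_smul_comm, hεε, one_smul, onFirstTwo_mul, superPerm_mul_self, onFirstTwo_one])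
    (by rw [smul_mul_smul_comm, hεε, one_smul, onLastTwo_mul, superPerm_mul_self, onLastTwo_one])
    (by simp only [smul_mul_smul_comm, superPerm_braid])
    (by rw [smul_mul_assoc, onFirstTwo_mul, superPerm_mul_cupCap hhisym, onFirstTwo_smul,
      smul_smul, hεε, one_smul])
    (by rw [mul_smul_comm, onFirstTwo_mul, cupCap_mul_superPerm hlosym, onFirstTwo_smul,
      smul_smul, hεε, one_smul])
    (by rw [smul_mul_assoc, onLastTwo_mul, superPerm_mul_cupCap hhisym, onLastTwo_smul,
      smul_smul, hεε, one_smul])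
    (by rw [mul_smul_comm, onLastTwo_mul, cupCap_mul_superPerm hlosym, onLastTwo_smul,
      smul_smul, hεε, one_smul])
    (by rw [onFirstTwo_mul, cupCap_mul_self, onFirstTwo_smul])
    (by rw [onLastTwo_mul, cupCap_mul_self, onLastTwo_smul])
    (cupCap_first_last_first hinv1 hinv2) (cupCap_last_first_last hinv1 hinv2)
    (by rw [smul_mul_assoc, smul_mul_assoc, superPerm_cupCap_last_first hhi0 hinv1])
    (by rw [mul_smul_comm, mul_smul_comm, mul_smul_comm, cupCap_first_last_superPerm hlo0 hinv2])
    u v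
  dsimp only at key
  rw [← hR12, ← hR23, ← hR23, smul_mul_assoc, smul_mul_smul_comm, hεε, one_smul, ← hconj] at key
  simpa only [mul_assoc] using key
end

section
/- With a supermetric and super-oscillator algebra as in the context, define F^{ab} := ε(−1)^{[b]}·(1/2)·(c^a c^b − ε(−1)^{[a][b]} c^b c^a), F^a_b := Σ_c ε_{bc} F^{ac}, and F_{b2 b1} := Σ_{a,c} ε_{b2 a} ε_{b1 c} F^{ac}. Then: (i) F^{ab} = −ε(−1)^{[a][b]+[a]+[b]} F^{ba} for all a, b; (ii) Σ_a (−1)^{[a]} F^a_a = 0; (iii) the osp supercommutation relations hold: for all a1, b1, a2, b2, F^{a1}_{b1}·F^{a2}_{b2} − (−1)^{([a1]+[b1])([a2]+[b2])} F^{a2}_{b2}·F^{a1}_{b1} = −ε(−1)^{[a1][a2]+[b1]([b2]+[a2])} δ^{a1}_{b2} F^{a2}_{b1} − ε(−1)^{[a2]+[b1]([b2]+[a2])} ε_{b1b2} F^{a1a2} + ε(−1)^{[b2]+[b1]([b2]+[a2])} ε̄^{a1a2} F_{b2b1} + ε(−1)^{[b1]} δ^{a2}_{b1} F^{a1}_{b2},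 where F^{a1a2} means the element F^{ab} defined above with (a,b) = (a1,a2). -/
theorem sg_add (x y : ZMod 2) : sg (x + y) = sg x * sg y := by
  have h : ∀ z : ZMod 2, z = 0 ∨ z = 1 := by decide
  have h2 : (1 : ZMod 2) + 1 = 0 := rfl
  rcases h x with rfl | rfl <;> rcases h y with rfl | rfl <;> simp [sg, h2]

theorem eq_of_add_eq_zero_zmod_two {x y : ZMod 2} (h : x + y = 0) : x = y := by
  revert x y
  decide

theorem mul_self_zmod_two (x : ZMod 2) : x * x = x := by
  revert x
  decide

/-- Moving `z * w` past `x * y` when each letter of one pair commutes with each letter of the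
other up to a scalar and a central correction. -/
theorem pair_exchange {A : Type*} [Ring A] [Algebra ℂ A] (x y z w : A)
    {r₁ r₂ r₃ r₄ g₁ g₂ g₃ g₄ : ℂ}
    (hyz : y * z = g₁ • (1 : A) - r₁ • (z * y)) (hyw : y * w = g₂ • (1 : A) - r₂ • (w * y))
    (hxz : x * z = g₃ • (1 : A) - r₃ • (z * x)) (hxw : x * w = g₄ • (1 : A) - r₄ • (w * x)) :
    x * y * (z * w) = g₁ • (x * w) - (r₁ * g₂) • (x * z) + (r₁ * r₂ * g₃) • (w * y)
      - (r₁ * r₂ * r₃ * g₄) • (z * y) + (r₁ * r₂ * r₃ * r₄) • (z * w * (x * y)) := by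
  have e₁ : x * y * (z * w) = g₁ • (x * w) - r₁ • (x * z * (y * w)) := by
    calc x * y * (z * w) = x * (y * z) * w := by noncomm_ring
      _ = _ := by
        rw [hyz]
        simp only [mul_sub, sub_mul, mul_smul_comm, smul_mul_assoc, mul_one, mul_assoc]
  have e₂ : x * z * (y * w) = g₂ • (x * z) - r₂ • (x * z * (w * y)) := by
    rw [hyw]
    simp only [mul_sub, mul_smul_comm, mul_one]
  have e₃ : x * z * (w * y) = g₃ • (w * y) - r₃ • (z * (x * w) * y) := by
    rw [hxz]
    simp only [sub_mul, smul_mul_assoc, one_mul, mul_assoc]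
  have e₄ : z * (x * w) * y = g₄ • (z * y) - r₄ • (z * w * (x * y)) := by
    rw [hxw]
    simp only [mul_sub, sub_mul, mul_smul_comm, smul_mul_assoc, mul_one, mul_assoc]
  rw [e₁, e₂, e₃, e₄]
  module

/-- The super-oscillator bilinears F^{ab} are graded-antisymmetric, supertraceless, and
satisfy the osp supercommutation relations. -/
theorem super_oscillator_osp_generators
    (n : ℕ) (p : Fin n → ZMod 2) (ε : ℂ) (hε : ε = 1 ∨ ε = -1)
    (εlo εhi : Matrix (Fin n) (Fin n) ℂ)
    (hlo0 : ∀ a b, p a + p b ≠ 0 → εlo a b = 0)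
    (hhi0 : ∀ a b, p a + p b ≠ 0 → εhi a b = 0)
    (hlosym : ∀ a b, εlo a b = ε * sg (p a * p b) * εlo b a)
    (hhisym : ∀ a b, εhi a b = ε * sg (p a * p b) * εhi b a)
    (hinv1 : ∀ a c, (∑ b, εhi a b * εlo b c) = if a = c then 1 else 0)
    (hinv2 : ∀ a c, (∑ b, εlo a b * εhi b c) = if a = c then 1 else 0)
    (A : Type*) [Ring A] [Algebra ℂ A] (c : Fin n → A)
    (hosc : ∀ a b, c a * c b + (ε * sg (p a * p b)) • (c b * c a) = εhi a b • (1 : A)) :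
    let F : Fin n → Fin n → A := fun a b =>
      (ε * sg (p b) * (1 / 2 : ℂ)) • (c a * c b - (ε * sg (p a * p b)) • (c b * c a))
    let Flow : Fin n → Fin n → A := fun a b => ∑ cc, εlo b cc • F a cc
    let Fdd : Fin n → Fin n → A := fun b2 b1 => ∑ a, ∑ cc, (εlo b2 a * εlo b1 cc) • F a cc
    -- (i) graded antisymmetry
    (∀ a b, F a b = (-(ε * sg (p a * p b + p a + p b))) • F b a) ∧
    -- (ii) vanishing supertrace
    (∑ a, sg (p a) • Flow a a) = 0 ∧
    -- (iii) osp supercommutation relations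
    (∀ a1 b1 a2 b2 : Fin n,
      Flow a1 b1 * Flow a2 b2 -
          sg ((p a1 + p b1) * (p a2 + p b2)) • (Flow a2 b2 * Flow a1 b1) =
        (-(ε * sg (p a1 * p a2 + p b1 * (p b2 + p a2))) *
            (if a1 = b2 then 1 else 0)) • Flow a2 b1 +
          (-(ε * sg (p a2 + p b1 * (p b2 + p a2))) * εlo b1 b2) • F a1 a2 +
          (ε * sg (p b2 + p b1 * (p b2 + p a2)) * εhi a1 a2) • Fdd b2 b1 +
          (ε * sg (p b1) * (if a2 = b1 then 1 else 0)) • Flow a1 b2) := by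
  intro F Flow Fdd
  have hε2 : ε * ε = 1 := by rcases hε with rfl | rfl <;> norm_num
  have hlo_sg : ∀ a b, εlo a b * sg (p b) = εlo a b * sg (p a) := fun a b => by
    by_cases h : p a + p b = 0
    · rw [eq_of_add_eq_zero_zmod_two h]
    · rw [hlo0 a b h]; ring
  have hlo_sg_mul : ∀ a b x, εlo a b * sg (p b * x) = εlo a b * sg (p a * x) := fun a b x => by
    by_cases h : p a + p b = 0
    · rw [eq_of_add_eq_zero_zmod_two h]
    · rw [hlo0 a b h]; ring
  set cl : Fin n → A := fun b => ∑ d, εlo b d • c d with hcl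
  have hF : ∀ a b, F a b = (ε * sg (p b)) • (c a * c b - (1 / 2 * εhi a b) • (1 : A)) := by
    intro a b
    have h := hosc a b
    simp only [F]
    rw [mul_smul _ (εhi a b), ← h]
    module
  have hanti : ∀ a b, F a b = (-(ε * sg (p a * p b + p a + p b))) • F b a := by
    intro a b
    have h1 := sg_mul_self (p a)
    have h2 := sg_mul_self (p a * p b)
    simp only [F, sg_add, mul_comm (p b) (p a)]
    match_scalars
    · linear_combination (-ε * sg (p b) / 2) * (sg (p a) ^ 2 * sg (p a * p b) ^ 2 * hε2
        + sg (p a) ^ 2 * h2 + h1)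
    · linear_combination (ε ^ 2 * sg (p b) * sg (p a * p b) / 2) * h1
  have hdelta : ∀ a b, ∑ d, εlo b d * εhi a d = ε * sg (p b) * (if a = b then 1 else 0) := by
    intro a b
    calc ∑ d, εlo b d * εhi a d = ∑ d, ε * sg (p b * p a) * (εlo b d * εhi d a) := by
          refine Finset.sum_congr rfl fun d _ => ?_
          rw [hhisym a d, mul_comm (p a)]
          linear_combination ε * εhi d a * hlo_sg_mul b d (p a)
      _ = _ := by
          rw [← Finset.mul_sum, hinv2]
          by_cases h : a = b
          · subst h; simp [mul_self_zmod_two]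
          · simp [h, Ne.symm h]
  have hFlow : ∀ a b, Flow a b =
      (ε * sg (p b)) • (c a * cl b) - (1 / 2 * if a = b then 1 else 0 : ℂ) • (1 : A) := by
    intro a b
    have h1 := sg_mul_self (p b)
    calc Flow a b = ∑ d, ((ε * sg (p b)) • (c a * (εlo b d • c d))
          - (1 / 2 * ε * sg (p b) * (εlo b d * εhi a d)) • (1 : A)) := by
          refine Finset.sum_congr rfl fun d _ => ?_
          rw [hF, mul_smul_comm]
          match_scalars
          · linear_combination ε * hlo_sg b d
          · linear_combination (-ε * εhi a d / 2) * hlo_sg b d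
      _ = _ := by
          rw [Finset.sum_sub_distrib, ← Finset.smul_sum, ← Finset.mul_sum, ← Finset.sum_smul,
            ← Finset.mul_sum, hdelta]
          congr 2
          linear_combination (1 / 2 * if a = b then 1 else 0 : ℂ)
            * (sg (p b) * sg (p b) * hε2 + h1)
  have hFdd : ∀ a b, Fdd a b =
      (ε * sg (p b)) • (cl a * cl b - (1 / 2 * εlo b a) • (1 : A)) := by
    intro a b
    calc Fdd a b = ∑ x, εlo a x • Flow x b := by
          simp only [Fdd, Flow, Finset.smul_sum, mul_smul]
      _ = (ε * sg (p b)) • (cl a * cl b) - (1 / 2 * εlo a b) • (1 : A) := by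
          simp only [hFlow, smul_sub, Finset.sum_sub_distrib]
          congr 1
          · rw [hcl, Finset.sum_mul, Finset.smul_sum]
            refine Finset.sum_congr rfl fun x _ => ?_
            rw [smul_mul_assoc, smul_comm]
          · simp only [smul_smul, ← Finset.sum_smul]
            simp [mul_comm]
      _ = _ := by
          have h1 := hlosym a b
          rw [mul_comm (p a)] at h1
          have h2 : εlo a b = ε * sg (p b) * εlo b a := by
            by_cases h : p b + p a = 0
            · rwa [← eq_of_add_eq_zero_zmod_two h, mul_self_zmod_two] at h1
            · rw [h1, hlo0 b a h]; ring
          rw [h2]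
          module
  have hdu : ∀ b a, cl b * c a = (if a = b then 1 else 0 : ℂ) • (1 : A)
      - (ε * sg (p b * p a)) • (c a * cl b) := by
    intro b a
    calc cl b * c a = ∑ d, ((εlo b d * εhi d a) • (1 : A)
          - (ε * sg (p b * p a)) • (c a * (εlo b d • c d))) := by
          rw [hcl, Finset.sum_mul]
          refine Finset.sum_congr rfl fun d _ => ?_
          rw [smul_mul_assoc, eq_sub_of_add_eq (hosc d a), mul_smul_comm]
          match_scalars
          · ring
          · linear_combination -ε * hlo_sg_mul b d (p a)
      _ = _ := by
          rw [Finset.sum_sub_distrib, ← Finset.smul_sum, ← Finset.mul_sum, ← Finset.sum_smul,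
            hinv2]
          simp only [hcl, eq_comm]
  have hsq : ∀ x, (ε * sg x) * (ε * sg x) = 1 := fun x => by
    linear_combination sg x * sg x * hε2 + sg_mul_self x
  have hud : ∀ a b, c a * cl b = (ε * sg (p a * p b) * if a = b then 1 else 0 : ℂ) • (1 : A)
      - (ε * sg (p a * p b)) • (cl b * c a) := by
    intro a b
    rw [hdu, mul_comm (p b), smul_sub, smul_smul, smul_smul, hsq]
    module
  have hdd : ∀ a b, cl a * cl b = εlo b a • (1 : A) - (ε * sg (p a * p b)) • (cl b * cl a) := by
    intro a b
    calc cl a * cl b = ∑ d, ((εlo a d * (ε * sg (p a * p b) * if d = b then 1 else 0)) • (1 : A)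
          - (ε * sg (p a * p b)) • (cl b * (εlo a d • c d))) := by
          conv_lhs => rw [hcl, Finset.sum_mul]
          refine Finset.sum_congr rfl fun d _ => ?_
          rw [smul_mul_assoc, hud, mul_smul_comm]
          match_scalars
          · linear_combination (ε * if d = b then 1 else 0) * hlo_sg_mul a d (p b)
          · linear_combination -ε * hlo_sg_mul a d (p b)
      _ = _ := by
          rw [Finset.sum_sub_distrib, ← Finset.smul_sum, ← Finset.mul_sum, ← Finset.sum_smul]
          congr 2
          simp only [mul_ite, mul_one, mul_zero, Finset.sum_ite_eq', Finset.mem_univ, if_true]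
          rw [hlosym b a, mul_comm (p b)]
          ring
  have huu : ∀ a b, c a * c b = εhi a b • (1 : A) - (ε * sg (p a * p b)) • (c b * c a) :=
    fun a b => eq_sub_of_add_eq (hosc a b)
  refine ⟨hanti, ?_, ?_⟩
  · have hswap : ∑ a, sg (p a) • Flow a a = -∑ a, sg (p a) • Flow a a := by
      simp only [Flow, Finset.smul_sum]
      conv_lhs => rw [Finset.sum_comm]
      simp only [← Finset.sum_neg_distrib]
      refine Finset.sum_congr rfl fun a _ => Finset.sum_congr rfl fun d _ => ?_
      rw [hanti d a]
      by_cases h : p a + p d = 0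
      · have h' := eq_of_add_eq_zero_zmod_two h
        rw [hlosym d a, ← h', sg_add, sg_add, mul_self_zmod_two]
        have h1 := sg_mul_self (p a)
        generalize F a d = f
        match_scalars
        linear_combination (-sg (p a) * εlo a d) * (sg (p a) ^ 4 * hε2 + (sg (p a) ^ 2 + 1) * h1)
      · rw [hlo0 a d h, hlo0 d a (by rwa [add_comm])]
        simp
    have : (2 : ℂ) • ∑ a, sg (p a) • Flow a a = 0 := by
      rw [two_smul]
      nth_rewrite 1 [hswap]
      exact neg_add_cancel _
    exact (smul_eq_zero_iff_right two_ne_zero).mp this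
  · intro a1 b1 a2 b2
    have hq := pair_exchange (c a1) (cl b1) (c a2) (cl b2) (hdu b1 a2) (hdd b1 b2) (huu a1 a2)
      (hud a1 b2)
    have hs := fun i => sg_mul_self (p i)
    have hlow : εlo b1 b2 * (sg (p b1) * sg (p b2)) = εlo b1 b2 := by
      linear_combination sg (p b1) * hlo_sg b1 b2 + εlo b1 b2 * hs b1
    have hd1 : sg (p a1 * p a2) * sg (p b1 * p a2) * sg (p a1 * p b2) * sg (p b1 * p b2)
        * (if a1 = b1 then 1 else 0) = if a1 = b1 then 1 else 0 := by
      by_cases h : a1 = b1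
      · subst h
        linear_combination (if a1 = a1 then 1 else 0) * (sg (p a1 * p b2) ^ 2
          * sg_mul_self (p a1 * p a2) + sg_mul_self (p a1 * p b2))
      · simp [h]
    have hd2 : sg (p a1 * p a2) * sg (p b1 * p a2) * sg (p a1 * p b2) * sg (p b1 * p b2)
        * (if a2 = b2 then 1 else 0) = if a2 = b2 then 1 else 0 := by
      by_cases h : a2 = b2
      · subst h
        linear_combination (if a2 = a2 then 1 else 0) * (sg (p b1 * p a2) ^ 2
          * sg_mul_self (p a1 * p a2) + sg_mul_self (p b1 * p a2))
      · simp [h]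
    have hd3 : sg (p a1 * p a2) * sg (p b1 * p a2) * sg (p b1 * p b2)
        * ((if a1 = b2 then 1 else 0) * (if a2 = b1 then 1 else 0))
        = sg (p b1) * ((if a1 = b2 then 1 else 0) * (if a2 = b1 then 1 else 0)) := by
      by_cases h : a1 = b2
      · by_cases h' : a2 = b1
        · subst h h'
          simp only [if_true, mul_self_zmod_two, mul_comm (p a2) (p a1)]
          linear_combination sg (p a2) * sg_mul_self (p a1 * p a2)
        · simp [h']
      · simp [h]
    rw [hFlow a1 b1, hFlow a2 b2, hFlow a2 b1, hFlow a1 b2, hF, hFdd]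
    simp only [mul_sub, sub_mul, smul_mul_assoc, mul_smul_comm, mul_one, one_mul, smul_sub]
    simp only [sg_add, mul_add, add_mul]
    rw [hq]
    match_scalars
    · ring
    · rw [hlosym b2 b1, mul_comm (p b2)]
      linear_combination (-sg (p b1 * p a2) * sg (p b1 * p b2) * εlo b1 b2) *
        (ε ^ 2 * sg (p b1) * sg (p b2) * hε2) - ε ^ 2 * sg (p b1 * p a2) * sg (p b1 * p b2)
          * (hlow - εlo b1 b2 * hs a2)
    · linear_combination (ε ^ 2 * sg (p b1) * sg (p b2) * sg (p b1 * p a2) * sg (p b1 * p b2)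
        * εhi a1 a2) * hε2
    · by_cases h : a1 = b2
      · subst h
        simp only [if_true, mul_self_zmod_two]
        linear_combination (-ε ^ 2 * sg (p b1) * sg (p b1 * p a2) * sg (p b1 * p a1)
          * sg (p a1 * p a2)) * ((ε ^ 2 + 1) * sg (p a1) ^ 2 * hε2 + hs a1)
      · simp [h]
    · linear_combination (ε ^ 2 * sg (p b1) * sg (p b2) * sg (p b1 * p a2) * sg (p b1 * p b2)
        * sg (p a1 * p a2) * sg (p a1 * p b2)) * (ε ^ 2 + 1) * hε2
    · linear_combination (1 / 2 * ε * sg (p b2)) * hd1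
    · linear_combination (1 / 2 * ε * sg (p b1)) * hd2
    · linear_combination (-1 / 4 * if a2 = b2 then 1 else 0) * hd1 - 1 / 2 * ε * hd3
        + (1 / 2 * ε ^ 2 * sg (p b1 * p a2) * sg (p b1 * p b2) * εhi a1 a2)
          * (hlow - εlo b1 b2 * hs a2)
end
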